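/- Let T be a densely defined self-adjoint operator on a complex Hilbert space H with bounded transform S, σ̃(S) = σ(S) ∩ (-1,1), and u(x) = x(1 - x²)^{-1/2}. For f ∈ C(σ(T)) (possibly unbounded), the operator f₀(T) defined on the dense domain C*_c(S)H (the linear span of vectors g(S)ψ with g ∈ C_c(σ̃(S)), ψ ∈ H) by linear extension of f₀(T) h(T)ψ = (fh)(T)ψ, for h ∈ C_c(σ(T)), is a densely defined closable operator; if moreover f is real-valued then f₀(T) is symmetric. -/

import Mathlib

noncomputable section

variable {H : Type*} [NormedAddCommGroup H] [InnerProductSpace ℂ H] [CompleteSpace H]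

/-- `S = T(I + T²)^{-1/2}`, the *bounded transform* of the (possibly unbounded) operator `T`.
This is witnessed by `C = (I + T²)⁻¹` (a positive bounded operator mapping into the domain of
`T²` with `(I + T²) ∘ C = I`, which determines `C` uniquely when `T` is self-adjoint) together
with its (unique) positive square root `R = (I + T²)^{-1/2}`, and `S = T ∘ R`. -/
def IsBoundedTransform (T : H →ₗ.[ℂ] H) (S : H →L[ℂ] H) : Prop :=
  ∃ C R : H →L[ℂ] H, C.IsPositive ∧ R.IsPositive ∧ R * R = C ∧
    (∀ x : H, ∃ (h1 : C x ∈ T.domain) (h2 : (T ⟨C x, h1⟩ : H) ∈ T.domain),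
        C x + T ⟨(T ⟨C x, h1⟩ : H), h2⟩ = x) ∧
    (∀ x : H, ∃ hx : R x ∈ T.domain, S x = T ⟨R x, hx⟩)

/-- `S` is a pure contraction: `‖Sx‖ < ‖x‖` for all `x ≠ 0`. -/
def PureContraction (S : H →L[ℂ] H) : Prop := ∀ x : H, x ≠ 0 → ‖S x‖ < ‖x‖

/-- `T = S(I - S²)^{-1/2}`: witnessed by the (unique) positive square root `R` of `I - S²`,
with `D(T) = ran R` and `T ∘ R = S`. -/
def IsInverseBoundedTransform (S : H →L[ℂ] H) (T : H →ₗ.[ℂ] H) : Prop :=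
  ∃ R : H →L[ℂ] H, R.IsPositive ∧ R * R = 1 - S * S ∧
    (T.domain : Set H) = Set.range R ∧
    (∀ x : H, ∃ hx : R x ∈ T.domain, (T ⟨R x, hx⟩ : H) = S x)

/-- The resolvent set of an unbounded operator: `z` such that `T - z` has a (bounded,
everywhere defined) two-sided inverse. -/
def pmapResolventSet (T : H →ₗ.[ℂ] H) : Set ℂ :=
  {z | ∃ B : H →L[ℂ] H,
    (∀ x : H, ∃ h : B x ∈ T.domain, (T ⟨B x, h⟩ : H) - z • B x = x) ∧
    (∀ ψ : T.domain, B ((T ψ : H) - z • (ψ : H)) = ψ)}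

/-- The spectrum of an unbounded operator. -/
def pmapSpectrum (T : H →ₗ.[ℂ] H) : Set ℂ := (pmapResolventSet T)ᶜ

/-- The real points of the spectrum of `T` (all of them, if `T` is self-adjoint). -/
def realSpec (T : H →ₗ.[ℂ] H) : Set ℝ := {x : ℝ | (x : ℂ) ∈ pmapSpectrum T}

/-- `g(S)` for a function `g : ℝ → ℂ`, via the continuous functional calculus of `S`. -/
def boundedCalc (S : H →L[ℂ] H) (g : ℝ → ℂ) : H →L[ℂ] H :=
  cfc (fun z : ℂ => g z.re) S

/-- The homeomorphism `u : (-1,1) → ℝ`, `u(x) = x(1 - x²)^{-1/2}`. -/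
def uFun : ℝ → ℝ := fun x => x / Real.sqrt (1 - x ^ 2)

/-- `h ∘ u`, extended by `0` outside `(-1,1)`. -/
def compU (h : ℝ → ℂ) : ℝ → ℂ :=
  fun x => if x ∈ Set.Ioo (-1 : ℝ) 1 then h (uFun x) else 0

/-- `h(T) := (h ∘ u)(S)`, for a function `h` on `σ(T)`, where `S` is the bounded
transform of `T`. -/
def pmapCalc (S : H →L[ℂ] H) (h : ℝ → ℂ) : H →L[ℂ] H := boundedCalc S (compU h)

/-- `σ̃(S) = σ(S) ∩ (-1,1)`. -/
def tildeSpec (S : H →L[ℂ] H) : Set ℝ := spectrum ℝ S ∩ Set.Ioo (-1) 1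

/-- `g ∈ C_c(Ω)`: continuous on `Ω`, vanishing outside a compact subset of `Ω`
(functions on `Ω` are encoded as functions on `ℝ` vanishing identically outside `Ω`). -/
def MemCc (g : ℝ → ℂ) (Ω : Set ℝ) : Prop :=
  ContinuousOn g Ω ∧ ∃ K : Set ℝ, IsCompact K ∧ K ⊆ Ω ∧ ∀ x ∉ K, g x = 0

/-- `g ∈ C₀(Ω)`: continuous on `Ω` and vanishing at infinity on `Ω`. -/
def MemC0 (g : ℝ → ℂ) (Ω : Set ℝ) : Prop :=
  ContinuousOn g Ω ∧ (∀ x ∉ Ω, g x = 0) ∧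
    ∀ ε > 0, ∃ K : Set ℝ, IsCompact K ∧ K ⊆ Ω ∧ ∀ x ∈ Ω \ K, ‖g x‖ < ε

/-- `g ∈ C_b(Ω)`: continuous and bounded on `Ω`. -/
def MemCb (g : ℝ → ℂ) (Ω : Set ℝ) : Prop :=
  ContinuousOn g Ω ∧ ∃ M : ℝ, ∀ x ∈ Ω, ‖g x‖ ≤ M

/-- The supremum norm `‖f‖_∞` of `f` over `Ω`. -/
def supNorm (f : ℝ → ℂ) (Ω : Set ℝ) : ℝ := sSup ((fun x => ‖f x‖) '' Ω)

/-- The subspace `C*_c(S)H`: the linear span of all `g(S)ψ` with `g ∈ C_c(σ̃(S))`. -/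
def ccSpan (S : H →L[ℂ] H) : Submodule ℂ H :=
  Submodule.span ℂ
    {v : H | ∃ g : ℝ → ℂ, MemCc g (tildeSpec S) ∧ ∃ ψ : H, v = boundedCalc S g ψ}

/-- The subspace `C*₀(S)H`: the linear span of all `g(S)ψ` with `g ∈ C₀(σ̃(S))`. -/
def c0Span (S : H →L[ℂ] H) : Submodule ℂ H :=
  Submodule.span ℂ
    {v : H | ∃ g : ℝ → ℂ, MemC0 g (tildeSpec S) ∧ ∃ ψ : H, v = boundedCalc S g ψ}

/-- `TR ⊂ RT`: the bounded operator `R` commutes with the unbounded operator `T`. -/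
def CommutesPMap (T : H →ₗ.[ℂ] H) (R : H →L[ℂ] H) : Prop :=
  ∀ ψ : T.domain, ∃ h : R (ψ : H) ∈ T.domain, (T ⟨R (ψ : H), h⟩ : H) = R (T ψ)

/-- `A = f₀(T)`: the operator with domain `C*_c(S)H` determined by
`f₀(T) h(T)ψ = (fh)(T)ψ` for `h ∈ C_c(σ(T))` (where `σT` is the spectrum of `T`,
and `h(T) = (h∘u)(S)`). -/
def IsF0 (S : H →L[ℂ] H) (σT : Set ℝ) (f : ℝ → ℂ) (A : H →ₗ.[ℂ] H) : Prop :=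
  A.domain = ccSpan S ∧
  ∀ h : ℝ → ℂ, MemCc h σT → ∀ ψ : H,
    ∃ hm : pmapCalc S h ψ ∈ A.domain,
      A ⟨pmapCalc S h ψ, hm⟩ = pmapCalc S (fun x => f x * h x) ψ

theorem IsSelfAdjoint.inner_graph {T : H →ₗ.[ℂ] H} (hsa : IsSelfAdjoint T) {x y x' y' : H}
    (h : (x, y) ∈ T.graph) (h' : (x', y') ∈ T.graph) : inner ℂ y x' = inner ℂ x y' := by
  have hform := LinearPMap.adjoint_isFormalAdjoint hsa.dense_domain
  rw [LinearPMap.isSelfAdjoint_def.mp hsa] at hform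
  obtain ⟨a, rfl, rfl⟩ := (LinearPMap.mem_graph_iff T).mp h
  obtain ⟨b, rfl, rfl⟩ := (LinearPMap.mem_graph_iff T).mp h'
  exact hform a b

theorem ContinuousLinearMap.IsPositive.denseRange_of_injective {C : H →L[ℂ] H} (hC : C.IsPositive)
    (hinj : ∀ x, C x = 0 → x = 0) : DenseRange C := by
  have h : (LinearMap.range C.toLinearMap).topologicalClosure = ⊤ := by
    rw [Submodule.topologicalClosure_eq_top_iff, ContinuousLinearMap.orthogonal_range,
      hC.isSelfAdjoint.adjoint_eq, LinearMap.ker_eq_bot']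
    exact hinj
  exact Submodule.dense_iff_topologicalClosure_eq_top.mpr h

theorem IsSelfAdjoint.eq_zero_of_graph {T : H →ₗ.[ℂ] H} (hsa : IsSelfAdjoint T) {d e : H}
    (h : (d, e) ∈ T.graph) (h' : (e, -d) ∈ T.graph) : d = 0 := by
  have h1 := hsa.inner_graph h h'
  rw [inner_neg_right, inner_self_eq_norm_sq_to_K, inner_self_eq_norm_sq_to_K] at h1
  have h2 : ‖e‖ ^ 2 = -‖d‖ ^ 2 := by exact_mod_cast h1
  have h3 : ‖d‖ = 0 := by nlinarith [sq_nonneg ‖e‖, sq_nonneg ‖d‖]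
  exact norm_eq_zero.mp h3

theorem IsBoundedTransform.isSelfAdjoint_and_exists_sqrt {T : H →ₗ.[ℂ] H} {S : H →L[ℂ] H}
    (hsa : IsSelfAdjoint T) (hbt : IsBoundedTransform T S) :
    IsSelfAdjoint S ∧ ∃ R : H →L[ℂ] H, R.IsPositive ∧ R * R = 1 - S * S ∧
      (∀ x, R x = 0 → x = 0) ∧ (∀ x, (R x, S x) ∈ T.graph) ∧
      ∀ x y, (x, y) ∈ T.graph → ∃ φ, x = R φ := by
  obtain ⟨C, R, hC, hR, hRR, hTC, hTR⟩ := hbt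
  have hRRx (x : H) : R (R x) = C x := by rw [← hRR]; rfl
  have gR (x : H) : (R x, S x) ∈ T.graph := by
    obtain ⟨hx, h⟩ := hTR x
    rw [h]
    exact T.mem_graph ⟨R x, hx⟩
  have gC (x : H) : (C x, S (R x)) ∈ T.graph := by simpa [hRRx] using gR (R x)
  have gCC (x : H) : (S (R x), x - C x) ∈ T.graph := by
    obtain ⟨h1, h2, h3⟩ := hTC x
    have e : T ⟨C x, h1⟩ = S (R x) :=
      T.mem_graph_snd_inj (T.mem_graph ⟨C x, h1⟩) (gC x) rfl
    have := T.mem_graph ⟨_, h2⟩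
    rw [← eq_sub_iff_add_eq'] at h3
    rw [h3] at this
    simpa [e] using this
  have hCinj (x : H) (hx : C x = 0) : x = 0 := by
    have e : S (R x) = 0 := T.graph_fst_eq_zero_snd (by simpa using gC x) hx
    simpa [hx] using T.graph_fst_eq_zero_snd (gCC x) e
  have hRinj (x : H) (hx : R x = 0) : x = 0 := hCinj x (by rw [← hRRx, hx, map_zero])
  have hcomm {x y : H} (h : (x, y) ∈ T.graph) : S (R x) = C y := by
    have h1 : (x - C x, y - S (R x)) ∈ T.graph := T.graph.sub_mem h (gC x)
    have h2 : (S (R x) - C y, x - C x - S (R y)) ∈ T.graph := T.graph.sub_mem (gCC x) (gC y)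
    have h3 : (x - C x - S (R y), y - S (R x) - (y - C y)) ∈ T.graph :=
      T.graph.sub_mem h1 (gCC y)
    refine sub_eq_zero.mp (hsa.eq_zero_of_graph h2 ?_)
    convert h3 using 2
    abel
  have hCS : Commute C S := by
    ext x
    simpa [hRRx] using (hcomm (gR x)).symm
  have hRS : Commute R S := by
    have hR0 : 0 ≤ R := (ContinuousLinearMap.nonneg_iff_isPositive R).mpr hR
    have hC0 : 0 ≤ C := (ContinuousLinearMap.nonneg_iff_isPositive C).mpr hC
    rw [← CFC.sqrt_unique hRR hR0, CFC.sqrt]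
    exact hCS.cfcₙ_nnreal _
  have hRSx (x : H) : R (S x) = S (R x) := DFunLike.congr_fun hRS.eq x
  have hRdense := hR.denseRange_of_injective hRinj
  have hRadj (x y : H) : inner ℂ (R x) y = inner ℂ x (R y) := hR.isSymmetric x y
  have hS : IsSelfAdjoint S := by
    rw [ContinuousLinearMap.isSelfAdjoint_iff_isSymmetric]
    intro x z
    change inner ℂ (S x) z = inner ℂ x (S z)
    refine hRdense.induction_on (p := fun z => inner ℂ (S x) z = inner ℂ x (S z)) z
      (isClosed_eq (by fun_prop) (by fun_prop)) fun y => ?_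
    rw [hsa.inner_graph (gR x) (gR y), hRadj, hRSx]
  have hSS : S * S = 1 - C := by
    ext x
    refine (hC.denseRange_of_injective hCinj).induction_on
      (p := fun x => (S * S) x = (1 - C : H →L[ℂ] H) x) x
      (isClosed_eq (by fun_prop) (by fun_prop)) fun y => ?_
    have := hcomm (gCC y)
    rw [hRSx, hRRx] at this
    simpa using this
  have hSSx (x : H) : S (S x) = x - C x := by simpa using DFunLike.congr_fun hSS x
  refine ⟨hS, R, hR, by rw [hRR, hSS, sub_sub_cancel], hRinj, gR, fun x y h => ?_⟩
  have h1 : S x = R y := by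
    rw [← sub_eq_zero]
    apply hRinj
    rw [map_sub, hRSx, hcomm h, hRRx, sub_self]
  refine ⟨R x + S y, ?_⟩
  rw [map_add, hRRx, hRSx, ← h1, hSSx, add_sub_cancel]

theorem one_sub_sq_nonneg_of_mem_spectrum {S R : H →L[ℂ] H} (hS : IsSelfAdjoint S)
    (hR : R.IsPositive) (hRR : R * R = 1 - S * S) {x : ℝ} (hx : x ∈ spectrum ℝ S) :
    0 ≤ 1 - x ^ 2 := by
  have h : cfc (fun x : ℝ => 1 - x ^ 2) S = R * R := by
    rw [hRR, cfc_sub .., cfc_const_one .., cfc_pow_id .., sq]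
  have h0 : 0 ≤ R * R := by
    have := star_mul_self_nonneg R
    rwa [hR.isSelfAdjoint.star_eq] at this
  apply spectrum_nonneg_of_nonneg h0
  rw [← h, cfc_map_spectrum (fun x : ℝ => 1 - x ^ 2) S]
  exact ⟨x, hx, rfl⟩

theorem cfc_sqrt_one_sub_sq {S R : H →L[ℂ] H} (hS : IsSelfAdjoint S)
    (hR : R.IsPositive) (hRR : R * R = 1 - S * S) :
    cfc (fun x : ℝ => √(1 - x ^ 2)) S = R := by
  have h0 : 0 ≤ cfc (fun x : ℝ => √(1 - x ^ 2)) S := cfc_nonneg fun x _ => Real.sqrt_nonneg _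
  have hR0 : 0 ≤ R := (ContinuousLinearMap.nonneg_iff_isPositive R).mpr hR
  have h : cfc (fun x : ℝ => √(1 - x ^ 2)) S * cfc (fun x : ℝ => √(1 - x ^ 2)) S = R * R := by
    rw [← cfc_mul .., hRR, cfc_congr (g := fun x : ℝ => 1 - x ^ 2), cfc_sub .., cfc_const_one ..,
      cfc_pow_id .., sq]
    intro x hx
    exact Real.mul_self_sqrt (one_sub_sq_nonneg_of_mem_spectrum hS hR hRR hx)
  rw [← CFC.sqrt_unique h h0, CFC.sqrt_unique rfl hR0]

theorem uFun_mem_realSpec {T : H →ₗ.[ℂ] H} {S R : H →L[ℂ] H} (hS : IsSelfAdjoint S)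
    (hR : R.IsPositive) (hRR : R * R = 1 - S * S) (hinj : ∀ x, R x = 0 → x = 0)
    (hgraph : ∀ x, (R x, S x) ∈ T.graph)
    (hran : ∀ x y, (x, y) ∈ T.graph → ∃ φ, x = R φ) {s : ℝ} (hs : s ∈ tildeSpec S) :
    uFun s ∈ realSpec T := by
  intro hu
  obtain ⟨B, hB1, hB2⟩ := hu
  set u := uFun s with hu
  let M : H →L[ℂ] H := S - u • R
  have hMx (x : H) : M x = S x - (u : ℂ) • R x := by simp [M]
  have hval (x : H) (h : R x ∈ T.domain) : T ⟨R x, h⟩ = S x :=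
    T.mem_graph_snd_inj (T.mem_graph ⟨R x, h⟩) (hgraph x) rfl
  have hM : IsUnit M := by
    rw [ContinuousLinearMap.isUnit_iff_bijective]
    constructor
    · rw [injective_iff_map_eq_zero]
      intro x hx
      have hd : R x ∈ T.domain := T.mem_domain_of_mem_graph (hgraph x)
      have := hB2 ⟨R x, hd⟩
      rw [hval, ← hMx, hx, map_zero] at this
      exact hinj x this.symm
    · intro y
      obtain ⟨hd, hy⟩ := hB1 y
      obtain ⟨φ, hφ⟩ : ∃ φ, B y = R φ := hran _ _ (T.mem_graph ⟨B y, hd⟩)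
      refine ⟨φ, ?_⟩
      have hd' : R φ ∈ T.domain := hφ ▸ hd
      simp only [hφ] at hy
      rw [hMx, ← hval φ hd', hy]
  have hMcfc : M = cfc (fun x : ℝ => x - u * √(1 - x ^ 2)) S := by
    rw [cfc_sub .., cfc_const_mul .., cfc_id' .., cfc_sqrt_one_sub_sq hS hR hRR]
  refine spectrum.zero_notMem ℝ hM ?_
  rw [hMcfc, cfc_map_spectrum (fun x : ℝ => x - u * √(1 - x ^ 2)) S]
  refine ⟨s, hs.1, ?_⟩
  have : 0 < 1 - s ^ 2 := by nlinarith [hs.2.1, hs.2.2]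
  have := Real.sqrt_pos.mpr this
  simp only [hu, uFun]
  field_simp
  simp

theorem re_mem_spectrum_real {S : H →L[ℂ] H} (hS : IsSelfAdjoint S) {z : ℂ}
    (hz : z ∈ spectrum ℂ S) : z.re ∈ spectrum ℝ S := by
  rw [← spectrum.algebraMap_mem_iff ℂ]
  rwa [hS.mem_spectrum_eq_re hz] at hz

theorem boundedCalc_congr {S : H →L[ℂ] H} (hS : IsSelfAdjoint S) {Φ Ψ : ℝ → ℂ}
    (h : ∀ x ∈ spectrum ℝ S, Φ x = Ψ x) : boundedCalc S Φ = boundedCalc S Ψ :=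
  cfc_congr fun _ hz => h _ (re_mem_spectrum_real hS hz)

/-- `Φ` vanishes outside a closed subset of `ℝ` contained in `(-1,1)`. -/
def VanishesNearEndpoints (Φ : ℝ → ℂ) : Prop :=
  ∃ K : Set ℝ, IsClosed K ∧ K ⊆ Set.Ioo (-1) 1 ∧ ∀ x ∉ K, Φ x = 0

theorem MemCc.vanishesNearEndpoints {g : ℝ → ℂ} {Ω : Set ℝ} (hg : MemCc g Ω)
    (hΩ : Ω ⊆ Set.Ioo (-1) 1) : VanishesNearEndpoints g := by
  obtain ⟨-, K, hK, hsub, h0⟩ := hg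
  exact ⟨K, hK.isClosed, hsub.trans hΩ, h0⟩

theorem VanishesNearEndpoints.continuousOn_comp_re {Φ : ℝ → ℂ} (h : VanishesNearEndpoints Φ)
    {S : H →L[ℂ] H} (hS : IsSelfAdjoint S) (hΦ : ContinuousOn Φ (tildeSpec S)) :
    ContinuousOn (fun z : ℂ => Φ z.re) (spectrum ℂ S) := by
  obtain ⟨K, hK, hsub, h0⟩ := h
  have key : ContinuousOn Φ (spectrum ℝ S) := by
    intro x hx
    by_cases hxI : x ∈ Set.Ioo (-1 : ℝ) 1
    · exact (continuousWithinAt_inter (isOpen_Ioo.mem_nhds hxI)).mp (hΦ x ⟨hx, hxI⟩)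
    · have hxK : x ∈ Kᶜ := fun h => hxI (hsub h)
      refine ContinuousAt.continuousWithinAt ?_
      refine continuousAt_const.congr (f := fun _ => (0 : ℂ)) ?_
      filter_upwards [hK.isOpen_compl.mem_nhds hxK] with y hy using (h0 y hy).symm
  exact key.comp Complex.continuous_re.continuousOn fun z hz => re_mem_spectrum_real hS hz

theorem VanishesNearEndpoints.exists_memCc {Φ : ℝ → ℂ} (h : VanishesNearEndpoints Φ)
    {S : H →L[ℂ] H} (hS : IsSelfAdjoint S) (hΦ : ContinuousOn Φ (tildeSpec S)) :
    ∃ g : ℝ → ℂ, MemCc g (tildeSpec S) ∧ (∀ x ∈ spectrum ℝ S, g x = Φ x) ∧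
      boundedCalc S Φ = boundedCalc S g := by
  obtain ⟨K, hK, hsub, h0⟩ := h
  have hval : ∀ x ∈ spectrum ℝ S, (tildeSpec S).indicator Φ x = Φ x := by
    intro x hx
    by_cases hxI : x ∈ tildeSpec S
    · exact Set.indicator_of_mem hxI Φ
    · rw [Set.indicator_of_notMem hxI, h0 x fun hxK => hxI ⟨hx, hsub hxK⟩]
  refine ⟨(tildeSpec S).indicator Φ, ⟨hΦ.congr fun x hx => hval x hx.1, spectrum ℝ S ∩ K,
    (ContinuousFunctionalCalculus.isCompact_spectrum S).inter_right hK,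
    Set.inter_subset_inter_right _ hsub, fun x hx => ?_⟩, hval,
    boundedCalc_congr hS fun x hx => (hval x hx).symm⟩
  by_cases hxI : x ∈ tildeSpec S
  · rw [Set.indicator_of_mem hxI, h0 x fun hxK => hx ⟨hxI.1, hxK⟩]
  · exact Set.indicator_of_notMem hxI Φ

theorem dense_ccSpan {S R : H →L[ℂ] H} (hS : IsSelfAdjoint S)
    (hR : R.IsPositive) (hRR : R * R = 1 - S * S) (hinj : ∀ x, R x = 0 → x = 0) :
    Dense (ccSpan S : Set H) := by
  have hRd := hR.denseRange_of_injective hinj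
  have hdense : DenseRange (R * R) := hRd.comp hRd R.continuous
  refine dense_closure.mp (hdense.mono ?_)
  rintro _ ⟨ψ, rfl⟩
  rw [Metric.mem_closure_iff]
  intro ε hε
  obtain ⟨δ, hδ, hδε⟩ : ∃ δ > 0, δ * ‖ψ‖ < ε :=
    ⟨ε / (‖ψ‖ + 1), by positivity, by
      rw [div_mul_eq_mul_div, div_lt_iff₀ (by positivity)]; nlinarith [norm_nonneg ψ]⟩
  let k : ℝ → ℂ := fun x => ((max 0 (1 - x ^ 2 - δ) : ℝ) : ℂ)
  have hk : Continuous k := by fun_prop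
  have hkv : VanishesNearEndpoints k := by
    refine ⟨{x | δ ≤ 1 - x ^ 2}, isClosed_le (by fun_prop) (by fun_prop), fun x hx => ?_,
      fun x hx => ?_⟩
    · have : δ ≤ 1 - x ^ 2 := hx
      constructor <;> nlinarith
    · have : 1 - x ^ 2 < δ := not_le.mp hx
      simp only [k]
      rw [max_eq_left (by linarith), Complex.ofReal_zero]
  obtain ⟨g, hg, -, hkg⟩ := hkv.exists_memCc hS hk.continuousOn
  refine ⟨boundedCalc S k ψ, Submodule.subset_span ⟨g, hg, ψ, by rw [hkg]⟩, ?_⟩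
  have hone : boundedCalc S (fun x => ((1 - x ^ 2 : ℝ) : ℂ)) = R * R := by
    have : boundedCalc S (fun x => ((1 - x ^ 2 : ℝ) : ℂ)) = cfc (fun z : ℂ => 1 - z ^ 2) S := by
      refine cfc_congr fun z hz => ?_
      have := hS.mem_spectrum_eq_re hz
      push_cast
      rw [← this]
    rw [this, cfc_sub .., cfc_const_one .., cfc_pow_id .., hRR, sq]
  have hnorm : ‖R * R - boundedCalc S k‖ ≤ δ := by
    rw [← hone, boundedCalc, boundedCalc, ← cfc_sub ..]
    refine norm_cfc_le hδ.le fun z hz => ?_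
    have := one_sub_sq_nonneg_of_mem_spectrum hS hR hRR (re_mem_spectrum_real hS hz)
    simp only [k]
    rw [← Complex.ofReal_sub, Complex.norm_real, Real.norm_eq_abs, abs_le]
    rcases max_cases 0 (1 - z.re ^ 2 - δ) with h | h <;> constructor <;> linarith
  rw [dist_eq_norm, ← sub_apply]
  exact ((R * R - boundedCalc S k).le_of_opNorm_le hnorm ψ).trans_lt hδε

/-- Continuous cutoff functions on `(-1,1)`, eventually equal to `1` on each compact subset. -/
def cutoff (n : ℕ) (x : ℝ) : ℝ := max 0 (min 1 (n * (1 - x ^ 2) - 1))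

theorem continuous_cutoff (n : ℕ) : Continuous (cutoff n) := by
  unfold cutoff
  fun_prop

theorem vanishesNearEndpoints_mul_cutoff (Φ : ℝ → ℂ) (n : ℕ) :
    VanishesNearEndpoints fun x => Φ x * cutoff n x := by
  refine ⟨{x | 1 ≤ n * (1 - x ^ 2)}, isClosed_le (by fun_prop) (by fun_prop), fun x hx => ?_,
    fun x hx => ?_⟩
  · have h1 : (1 : ℝ) ≤ n * (1 - x ^ 2) := hx
    have h2 : 0 < 1 - x ^ 2 := pos_of_mul_pos_right (by linarith) (Nat.cast_nonneg n)
    constructor <;> nlinarith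
  · have h1 : n * (1 - x ^ 2) < 1 := not_le.mp hx
    have h2 : cutoff n x = 0 := max_eq_left ((min_le_right _ _).trans (by linarith))
    simp only [h2, Complex.ofReal_zero, mul_zero]

theorem eventually_cutoff_eq_one {K : Set ℝ} (hK : IsCompact K) (hsub : K ⊆ Set.Ioo (-1) 1) :
    ∀ᶠ n in Filter.atTop, ∀ x ∈ K, cutoff n x = 1 := by
  obtain ⟨δ, hδ, hKδ⟩ : ∃ δ > 0, ∀ x ∈ K, δ ≤ 1 - x ^ 2 := by
    rcases K.eq_empty_or_nonempty with rfl | hne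
    · exact ⟨1, one_pos, by simp⟩
    · obtain ⟨y, hy, hmin⟩ := hK.exists_isMinOn (f := fun x : ℝ => 1 - x ^ 2) hne (by fun_prop)
      exact ⟨1 - y ^ 2, by nlinarith [(hsub hy).1, (hsub hy).2], fun x hx => hmin hx⟩
  obtain ⟨N, hN⟩ := exists_nat_ge (2 / δ)
  filter_upwards [Filter.eventually_ge_atTop N] with n hn x hx
  have h1 : 2 / δ ≤ n := hN.trans (by exact_mod_cast hn)
  rw [div_le_iff₀ hδ] at h1
  have h2 : (n : ℝ) * δ ≤ n * (1 - x ^ 2) :=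
    mul_le_mul_of_nonneg_left (hKδ x hx) (Nat.cast_nonneg n)
  rw [cutoff, min_eq_left (by linarith), max_eq_right zero_le_one]

/-- `Φ(S)` truncated away from the endpoints of `(-1,1)`. -/
def truncCalc (S : H →L[ℂ] H) (Φ : ℝ → ℂ) (n : ℕ) : H →L[ℂ] H :=
  boundedCalc S fun x => Φ x * cutoff n x

theorem eventually_truncCalc_boundedCalc {S : H →L[ℂ] H} (hS : IsSelfAdjoint S) {Φ g : ℝ → ℂ}
    (hΦ : ContinuousOn Φ (tildeSpec S)) (hg : MemCc g (tildeSpec S)) (ψ : H) :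
    ∀ᶠ n in Filter.atTop,
      truncCalc S Φ n (boundedCalc S g ψ) = boundedCalc S (fun x => Φ x * g x) ψ := by
  obtain ⟨K, hK, hsub, h0⟩ := hg.2
  filter_upwards [eventually_cutoff_eq_one hK fun x hx => (hsub hx).2] with n hn
  have hc : ContinuousOn (fun x => Φ x * (cutoff n x : ℂ)) (tildeSpec S) :=
    hΦ.mul (Complex.continuous_ofReal.comp (continuous_cutoff n)).continuousOn
  rw [truncCalc, boundedCalc, boundedCalc, ← mul_apply_eq_comp,
    ← cfc_mul _ _ S ((vanishesNearEndpoints_mul_cutoff Φ n).continuousOn_comp_re hS hc)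
      ((hg.vanishesNearEndpoints Set.inter_subset_right).continuousOn_comp_re hS hg.1)]
  congr 2
  ext z
  by_cases hz : z.re ∈ K
  · simp only [hn _ hz, Complex.ofReal_one, mul_one]
  · simp only [h0 _ hz, mul_zero]

theorem exists_tendsto_truncCalc {S : H →L[ℂ] H} (hS : IsSelfAdjoint S) {Φ : ℝ → ℂ}
    (hΦ : ContinuousOn Φ (tildeSpec S)) {v : H} (hv : v ∈ ccSpan S) :
    ∃ w, Filter.Tendsto (fun n => truncCalc S Φ n v) Filter.atTop (nhds w) := by
  induction hv using Submodule.span_induction with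
  | mem v hv =>
    obtain ⟨g, hg, ψ, rfl⟩ := hv
    exact ⟨_, tendsto_const_nhds.congr'
      ((eventually_truncCalc_boundedCalc hS hΦ hg ψ).mono fun n h => h.symm)⟩
  | zero => exact ⟨0, by simp⟩
  | add x y _ _ hx hy =>
    obtain ⟨a, ha⟩ := hx
    obtain ⟨b, hb⟩ := hy
    exact ⟨a + b, by simpa using ha.add hb⟩
  | smul c x _ hx =>
    obtain ⟨a, ha⟩ := hx
    exact ⟨c • a, by simpa using ha.const_smul c⟩

theorem tendsto_truncCalc {S : H →L[ℂ] H} (hS : IsSelfAdjoint S) {Φ : ℝ → ℂ}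
    (hΦ : ContinuousOn Φ (tildeSpec S)) {v : H} (hv : v ∈ ccSpan S) :
    Filter.Tendsto (fun n => truncCalc S Φ n v) Filter.atTop
      (nhds (Filter.atTop.limUnder fun n => truncCalc S Φ n v)) :=
  tendsto_nhds_limUnder (exists_tendsto_truncCalc hS hΦ hv)

/-- The operator `Φ(S)` with domain `C*_c(S)H`, for `Φ` continuous on `σ̃(S)`. -/
def ccOperator {S : H →L[ℂ] H} (hS : IsSelfAdjoint S) {Φ : ℝ → ℂ}
    (hΦ : ContinuousOn Φ (tildeSpec S)) : H →ₗ.[ℂ] H where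
  domain := ccSpan S
  toFun :=
    { toFun := fun v => Filter.atTop.limUnder fun n => truncCalc S Φ n v
      map_add' := fun v w => Filter.Tendsto.limUnder_eq <| by
        simpa using (tendsto_truncCalc hS hΦ v.2).add (tendsto_truncCalc hS hΦ w.2)
      map_smul' := fun c v => Filter.Tendsto.limUnder_eq <| by
        simpa using (tendsto_truncCalc hS hΦ v.2).const_smul c }

theorem ccOperator_boundedCalc {S : H →L[ℂ] H} (hS : IsSelfAdjoint S) {Φ g : ℝ → ℂ}
    (hΦ : ContinuousOn Φ (tildeSpec S)) (hg : MemCc g (tildeSpec S)) (ψ : H)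
    (hm : boundedCalc S g ψ ∈ (ccOperator hS hΦ).domain) :
    ccOperator hS hΦ ⟨boundedCalc S g ψ, hm⟩ = boundedCalc S (fun x => Φ x * g x) ψ :=
  Filter.Tendsto.limUnder_eq <| tendsto_const_nhds.congr' <|
    (eventually_truncCalc_boundedCalc hS hΦ hg ψ).mono fun _ h => h.symm

theorem isFormalAdjoint_ccOperator {S : H →L[ℂ] H} (hS : IsSelfAdjoint S) {Φ Ψ : ℝ → ℂ}
    (hΦ : ContinuousOn Φ (tildeSpec S)) (hΨ : ContinuousOn Ψ (tildeSpec S))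
    (h : ∀ x ∈ tildeSpec S, Ψ x = star (Φ x)) :
    (ccOperator hS hΦ).IsFormalAdjoint (ccOperator hS hΨ) := by
  have hstar (n : ℕ) : star (truncCalc S Φ n) = truncCalc S Ψ n := by
    rw [truncCalc, boundedCalc, ← cfc_star]
    refine boundedCalc_congr hS (Φ := fun x => star (Φ x * cutoff n x)) fun x hx => ?_
    by_cases hxI : x ∈ tildeSpec S
    · simp [h x hxI, mul_comm]
    · obtain ⟨K, -, hsub, h0⟩ := vanishesNearEndpoints_mul_cutoff (fun _ => 1) n
      have := h0 x fun hxK => hxI ⟨hx, hsub hxK⟩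
      simp only [one_mul] at this
      simp [this]
  intro v w
  have h1 := (tendsto_truncCalc hS hΦ v.2).inner (𝕜 := ℂ) (tendsto_const_nhds (x := (w : H)))
  have h2 := (tendsto_const_nhds (x := (v : H))).inner (𝕜 := ℂ) (tendsto_truncCalc hS hΨ w.2)
  refine tendsto_nhds_unique h1 (h2.congr fun n => ?_)
  rw [← hstar, ContinuousLinearMap.star_eq_adjoint, ContinuousLinearMap.adjoint_inner_right]

theorem continuousOn_uFun : ContinuousOn uFun (Set.Ioo (-1) 1) := by
  refine continuousOn_id.div (by fun_prop) fun x hx => ?_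
  exact (Real.sqrt_pos.mpr (by nlinarith [hx.1, hx.2])).ne'

theorem continuousOn_compU {Ω σT : Set ℝ} (hΩ : Ω ⊆ Set.Ioo (-1) 1) (hu : Set.MapsTo uFun Ω σT)
    {f : ℝ → ℂ} (hf : ContinuousOn f σT) : ContinuousOn (compU f) Ω :=
  (hf.comp (continuousOn_uFun.mono hΩ) hu).congr fun _ hx => if_pos (hΩ hx)

theorem MemCc.vanishesNearEndpoints_compU {h : ℝ → ℂ} {Ω : Set ℝ} (hh : MemCc h Ω) :
    VanishesNearEndpoints (compU h) := by
  obtain ⟨-, K, hK, -, h0⟩ := hh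
  obtain ⟨M, hM⟩ := hK.isBounded.exists_norm_le
  refine ⟨{x | x ^ 2 ≤ M ^ 2 * (1 - x ^ 2)}, isClosed_le (by fun_prop) (by fun_prop),
    fun x hx => ?_, fun x hx => ?_⟩
  · have h1 : x ^ 2 ≤ M ^ 2 * (1 - x ^ 2) := hx
    have h2 : 0 < 1 - x ^ 2 := by nlinarith [sq_nonneg M]
    constructor <;> nlinarith
  · by_cases hxI : x ∈ Set.Ioo (-1 : ℝ) 1
    · rw [compU, if_pos hxI]
      refine h0 _ fun hxK => hx ?_
      have h1 : 0 < 1 - x ^ 2 := by nlinarith [hxI.1, hxI.2]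
      have h2 : uFun x ^ 2 ≤ M ^ 2 := by
        rw [← sq_abs]
        exact pow_le_pow_left₀ (abs_nonneg _) (hM _ hxK) 2
      rwa [uFun, div_pow, Real.sq_sqrt h1.le, div_le_iff₀ h1] at h2
    · exact if_neg hxI

theorem isF0_ccOperator {S : H →L[ℂ] H} (hS : IsSelfAdjoint S) {σT : Set ℝ}
    (hu : Set.MapsTo uFun (tildeSpec S) σT) {f : ℝ → ℂ}
    (hΦ : ContinuousOn (compU f) (tildeSpec S)) : IsF0 S σT f (ccOperator hS hΦ) := by
  refine ⟨rfl, fun h hh ψ => ?_⟩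
  obtain ⟨g, hg, hval, heq⟩ := hh.vanishesNearEndpoints_compU.exists_memCc hS
    (continuousOn_compU Set.inter_subset_right hu hh.1)
  rw [pmapCalc, heq]
  have hm : boundedCalc S g ψ ∈ (ccOperator hS hΦ).domain :=
    Submodule.subset_span ⟨g, hg, ψ, rfl⟩
  refine ⟨hm, (ccOperator_boundedCalc hS hΦ hg ψ hm).trans ?_⟩
  rw [pmapCalc]
  congr 1
  refine boundedCalc_congr hS fun x hx => ?_
  rw [hval x hx]
  by_cases hxI : x ∈ Set.Ioo (-1 : ℝ) 1 <;> simp [compU, hxI]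

/-- For `f ∈ C(σ(T))` (possibly unbounded), the operator `f₀(T)` on the domain `C*_c(S)H`,
determined by `f₀(T) h(T)ψ = (fh)(T)ψ` for `h ∈ C_c(σ(T))`, exists, is densely defined and
closable; if `f` is real-valued it is moreover symmetric. -/
theorem f0T_closable (T : H →ₗ.[ℂ] H) (S : H →L[ℂ] H)
    (hdense : Dense (T.domain : Set H)) (hsa : IsSelfAdjoint T)
    (hbt : IsBoundedTransform T S) (f : ℝ → ℂ) (hf : ContinuousOn f (realSpec T)) :
    ∃ A : H →ₗ.[ℂ] H, IsF0 S (realSpec T) f A ∧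
      Dense (A.domain : Set H) ∧ A.IsClosable ∧
      ((∀ x ∈ realSpec T, (f x).im = 0) →
        ∀ φ ψ : A.domain,
          (inner (𝕜 := ℂ) (A φ) ((ψ : H))) = inner (𝕜 := ℂ) ((φ : H)) (A ψ)) := by
  obtain ⟨hS, R, hR, hRR, hinj, hgraph, hran⟩ := hbt.isSelfAdjoint_and_exists_sqrt hsa
  have hu : Set.MapsTo uFun (tildeSpec S) (realSpec T) := fun s hs =>
    uFun_mem_realSpec hS hR hRR hinj hgraph hran hs
  have hΦ := continuousOn_compU Set.inter_subset_right hu hf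
  have hd := dense_ccSpan hS hR hRR hinj
  refine ⟨ccOperator hS hΦ, isF0_ccOperator hS hu hΦ, hd, ?_, fun hreal => ?_⟩
  · have hform := isFormalAdjoint_ccOperator hS hΦ hΦ.star fun _ _ => rfl
    exact (LinearPMap.adjoint_isClosed hd).isClosable.leIsClosable (hform.symm.le_adjoint hd)
  · refine isFormalAdjoint_ccOperator hS hΦ hΦ fun x hx => ?_
    rw [compU, if_pos hx.2]
    exact (Complex.conj_eq_iff_im.mpr (hreal _ (hu hx))).symm
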